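/- For an odd positive integer q and an integer a with gcd(a, q) = 1, G(a,0;q) = (a/q) ε_q √q, where (a/q) is the Jacobi symbol and ε_q = 1 if q ≡ 1 (mod 4) and ε_q = i if q ≡ 3 (mod 4). -/

import Mathlib

/-- `e(x) = exp(2πix)` -/
noncomputable def e (x : ℝ) : ℂ := Complex.exp (2 * Real.pi * Complex.I * x)

/-- The quadratic Gauss sum `G(a,b;q) = ∑_{d mod q} e((a d² + b d)/q)`. -/
noncomputable def gaussG (a b : ℤ) (q : ℕ) : ℂ :=
  ∑ d ∈ Finset.range q, e (((a * d ^ 2 + b * d : ℤ) : ℝ) / q)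

theorem finEquiv_toEquiv_apply (n : ℕ) [NeZero n] (d : Fin n) :
    (ZMod.finEquiv n).toEquiv d = ((d : ℕ) : ZMod n) := by
  obtain ⟨n, rfl⟩ := Nat.exists_eq_succ_of_ne_zero (NeZero.ne n)
  exact (Fin.cast_val_eq_self d).symm

open ZMod in
/-- The Gauss sum `G(a,0;q)` in terms of the standard additive character of `ZMod q`. -/
theorem gaussG_eq_sum_range (a : ℤ) (q : ℕ) [NeZero q] :
    gaussG a 0 q =
      ∑ d ∈ Finset.range q, stdAddChar (((a * (d : ℤ) ^ 2 : ℤ)) : ZMod q) := by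
  refine Finset.sum_congr rfl fun d _ ↦ ?_
  rw [stdAddChar_coe, e]
  congr 1
  push_cast
  ring

open ZMod in
theorem gaussG_eq_sum_zmod (a : ℤ) (q : ℕ) [NeZero q] :
    gaussG a 0 q = ∑ x : ZMod q, stdAddChar ((a : ZMod q) * x ^ 2) := by
  rw [gaussG_eq_sum_range, Finset.sum_range fun d : ℕ ↦
    (stdAddChar (((a * (d : ℤ) ^ 2 : ℤ)) : ZMod q) : ℂ)]
  refine Fintype.sum_equiv (ZMod.finEquiv q).toEquiv _ _ fun d ↦ ?_
  rw [finEquiv_toEquiv_apply]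
  push_cast
  rfl

open ZMod in
theorem stdAddChar_natCast_mul (m n : ℕ) [NeZero m] [NeZero n] (j : ℤ) :
    stdAddChar (((n * j : ℤ)) : ZMod (m * n)) = stdAddChar (j : ZMod m) := by
  rw [stdAddChar_coe, stdAddChar_coe]
  have hn : (n : ℂ) ≠ 0 := NeZero.ne _
  have hm : (m : ℂ) ≠ 0 := NeZero.ne _
  congr 1
  push_cast
  field_simp

theorem bijective_crt_combination {m n : ℕ} [NeZero m] [NeZero n] (hmn : m.Coprime n) :
    Function.Bijective fun z : ZMod m × ZMod n ↦
      (((n * z.1.val + m * z.2.val : ℤ)) : ZMod (m * n)) := by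
  rw [Fintype.bijective_iff_injective_and_card]
  refine ⟨?_, by simp [ZMod.card]⟩
  rintro ⟨x, y⟩ ⟨x', y'⟩ h
  have h1 := congrArg (ZMod.castHom (dvd_mul_right m n) (ZMod m)) h
  have h2 := congrArg (ZMod.castHom (dvd_mul_left n m) (ZMod n)) h
  simp only [map_intCast] at h1 h2
  push_cast at h1 h2
  simp only [ZMod.natCast_val, ZMod.cast_id', id, CharP.cast_eq_zero, zero_mul, add_zero,
    zero_add] at h1 h2
  have hu : IsUnit (n : ZMod m) := (ZMod.isUnit_iff_coprime n m).2 hmn.symm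
  have hv : IsUnit (m : ZMod n) := (ZMod.isUnit_iff_coprime m n).2 hmn
  exact Prod.ext (hu.mul_left_cancel h1) (hv.mul_left_cancel h2)

open ZMod in
theorem gaussG_mul_of_coprime (a : ℤ) {m n : ℕ} [NeZero m] [NeZero n] (hmn : m.Coprime n) :
    gaussG a 0 (m * n) = gaussG (a * n) 0 m * gaussG (a * m) 0 n := by
  rw [gaussG_eq_sum_zmod, gaussG_eq_sum_zmod, gaussG_eq_sum_zmod,
    ← (bijective_crt_combination hmn).sum_comp, Fintype.sum_prod_type, Finset.sum_mul_sum]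
  refine Finset.sum_congr rfl fun x _ ↦ Finset.sum_congr rfl fun y _ ↦ ?_
  have hx : ((a * n : ℤ) : ZMod m) * x ^ 2 = ((a * n * (x.val : ℤ) ^ 2 : ℤ) : ZMod m) := by
    push_cast
    simp
  have hy : ((a * m : ℤ) : ZMod n) * y ^ 2 = ((a * m * (y.val : ℤ) ^ 2 : ℤ) : ZMod n) := by
    push_cast
    simp
  have hswap : stdAddChar (((m * (a * m * (y.val : ℤ) ^ 2) : ℤ)) : ZMod (m * n)) =
      stdAddChar (((a * m * (y.val : ℤ) ^ 2 : ℤ)) : ZMod n) := by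
    rw [← stdAddChar_natCast_mul n m, stdAddChar_coe, stdAddChar_coe]
    push_cast
    rw [mul_comm (m : ℂ) (n : ℂ)]
  rw [hx, hy, ← stdAddChar_natCast_mul m n, ← hswap, ← AddChar.map_add_eq_mul]
  congr 1
  have h0 : (m : ZMod (m * n)) * n = 0 := by exact_mod_cast ZMod.natCast_self (m * n)
  push_cast
  linear_combination (2 * a * (x.val : ZMod (m * n)) * y.val) * h0

open ZMod in
theorem gaussG_prime (a : ℤ) (p : ℕ) [Fact p.Prime] (hp : p ≠ 2) (ha : (a : ZMod p) ≠ 0) :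
    gaussG a 0 p = jacobiSym a p * gaussG 1 0 p := by
  have key (b : ℤ) (hb : (b : ZMod p) ≠ 0) : gaussG b 0 p =
      jacobiSym b p * gaussSum ((quadraticChar (ZMod p)).ringHomComp (Int.castRingHom ℂ))
        stdAddChar := by
    set χ := (quadraticChar (ZMod p)).ringHomComp (Int.castRingHom ℂ) with hχ
    have hfib : gaussG b 0 p =
        ∑ t : ZMod p, (χ t + 1) * stdAddChar ((b : ZMod p) * t) := by
      rw [gaussG_eq_sum_zmod, ← Finset.sum_fiberwise _ (fun x : ZMod p ↦ x ^ 2)]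
      refine Finset.sum_congr rfl fun t _ ↦ ?_
      rw [Finset.sum_congr rfl (g := fun _ ↦ stdAddChar ((b : ZMod p) * t))
        (fun x hx ↦ by rw [(Finset.mem_filter.1 hx).2]), Finset.sum_const, nsmul_eq_mul]
      congr 1
      have h := quadraticChar_card_sqrts (F := ZMod p) ((ZMod.ringChar_zmod_n p).substr hp) t
      simp only [Set.toFinset_ofPred] at h
      rw [hχ, MulChar.ringHomComp_apply, eq_intCast]
      exact_mod_cast congrArg (Int.cast : ℤ → ℂ) h
    have hzero : ∑ t : ZMod p, stdAddChar ((b : ZMod p) * t) = (0 : ℂ) := by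
      simpa [mul_comm, hb] using
        AddChar.sum_mulShift (b : ZMod p) (isPrimitive_stdAddChar p)
    have hsh := gaussSum_mulShift χ stdAddChar (Units.mk0 _ hb)
    have hsq : (χ b) ^ 2 = 1 := by
      rw [hχ, MulChar.ringHomComp_apply]
      rw [← map_pow, quadraticChar_sq_one hb, map_one]
    have hj : (jacobiSym b p : ℂ) = χ b := by
      rw [← jacobiSym.legendreSym.to_jacobiSym, hχ, MulChar.ringHomComp_apply]
      rfl
    have hsum : gaussG b 0 p = gaussSum χ (AddChar.mulShift stdAddChar (b : ZMod p)) := by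
      rw [hfib]
      simp only [add_mul, one_mul, Finset.sum_add_distrib, hzero, add_zero]
      rfl
    rw [Units.val_mk0] at hsh
    rw [hsum, hj, ← hsh, ← mul_assoc, ← sq, hsq, one_mul]
  rw [key a ha, key 1 (by simp), jacobiSym.one_left]
  simp

open ZMod in
theorem gaussG_prime_sq_mul (a : ℤ) (p m : ℕ) [Fact p.Prime] [NeZero m] (hp : p ≠ 2)
    (ha : (a : ZMod p) ≠ 0) : gaussG a 0 (p * (p * m)) = p * gaussG a 0 m := by
  have h2 : (2 : ZMod p) ≠ 0 := by
    have := Fact.out (p := p.Prime)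
    have h := (ZMod.natCast_eq_zero_iff 2 p).not.2
      (fun h ↦ hp ((Nat.prime_dvd_prime_iff_eq this Nat.prime_two).1 h))
    exact_mod_cast h
  let f (d : ℕ) : ℂ := stdAddChar (((a * (d : ℤ) ^ 2 : ℤ)) : ZMod (p * (p * m)))
  have inner (j : ℕ) : ∑ i : Fin p, f (j + p * m * i) = if p ∣ j then p * f j else 0 := by
    have hterm (i : Fin p) : f (j + p * m * i) =
        f j * stdAddChar (((i : ℕ) : ZMod p) * (2 * a * j) : ZMod p) := by
      have hc : ((i : ℕ) : ZMod p) * (2 * a * j) = ((i * (2 * a * j) : ℤ) : ZMod p) := by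
        push_cast
        ring
      rw [hc, ← stdAddChar_natCast_mul p (p * m), ← AddChar.map_add_eq_mul]
      dsimp only [f]
      congr 1
      have h0 : (p : ZMod (p * (p * m))) * (p * m) = 0 := by
        exact_mod_cast ZMod.natCast_self (p * (p * m))
      push_cast
      linear_combination (a * m * ((i : ℕ) : ZMod (p * (p * m))) ^ 2) * h0
    have hsum : ∑ i : Fin p, (stdAddChar (((i : ℕ) : ZMod p) * (2 * a * j) : ZMod p) : ℂ) =
        if p ∣ j then (p : ℂ) else 0 := by
      have h := AddChar.sum_mulShift (2 * a * j : ZMod p) (isPrimitive_stdAddChar p)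
      have hj : (2 * a * j : ZMod p) = 0 ↔ p ∣ j := by
        simp [h2, ha, ZMod.natCast_eq_zero_iff]
      simp only [hj, ZMod.card] at h
      rw [Nat.cast_ite, Nat.cast_zero] at h
      rw [← h]
      refine Fintype.sum_equiv (ZMod.finEquiv p).toEquiv _ _ fun d ↦ ?_
      rw [finEquiv_toEquiv_apply]
    simp only [hterm, ← Finset.mul_sum, hsum]
    split_ifs <;> ring
  have hf (t : ℕ) : f (p * t) = stdAddChar (((a * (t : ℤ) ^ 2 : ℤ)) : ZMod m) := by
    rw [stdAddChar_coe]
    dsimp only [f]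
    rw [stdAddChar_coe]
    have hm : (m : ℂ) ≠ 0 := NeZero.ne _
    have hp : (p : ℂ) ≠ 0 := NeZero.ne _
    congr 1
    push_cast
    field_simp
  calc gaussG a 0 (p * (p * m)) = ∑ d : Fin (p * (p * m)), f d := by
        rw [gaussG_eq_sum_range, Finset.sum_range]
    _ = ∑ j : Fin (p * m), ∑ i : Fin p, f (j + p * m * i) := by
        rw [← finProdFinEquiv.sum_comp, Fintype.sum_prod_type, Finset.sum_comm]
        rfl
    _ = ∑ j ∈ Finset.range (p * m), if p ∣ j then p * f j else 0 := by
        simp only [inner, Finset.sum_range]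
    _ = ∑ j ∈ Finset.range (m * p), if p ∣ j then p * f j else 0 := by rw [mul_comm p m]
    _ = ∑ t : Fin m, ∑ s : Fin p,
          if p ∣ (s + p * t : ℕ) then p * f (s + p * t) else 0 := by
        rw [Finset.sum_range, ← finProdFinEquiv.sum_comp, Fintype.sum_prod_type]
        rfl
    _ = ∑ t : Fin m, p * f (p * t) := by
        refine Finset.sum_congr rfl fun t _ ↦ ?_
        rw [Fintype.sum_eq_single (0 : Fin p)]
        · simp
        · intro s hs
          refine if_neg fun h ↦ hs (Fin.ext ?_)
          exact Nat.eq_zero_of_dvd_of_lt ((Nat.dvd_add_left (dvd_mul_right _ _)).1 h) s.2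
    _ = p * gaussG a 0 m := by
        rw [gaussG_eq_sum_range, Finset.sum_range, Finset.mul_sum]
        simp only [hf]

theorem gaussG_eq_jacobiSym_mul (q : ℕ) (hodd : Odd q) (a : ℤ) (h : IsCoprime a (q : ℤ)) :
    gaussG a 0 q = jacobiSym a q * gaussG 1 0 q := by
  induction q using Nat.strong_induction_on generalizing a with
  | _ q ih =>
    have hq0 : q ≠ 0 := hodd.pos.ne'
    rcases eq_or_ne q 1 with rfl | hq1
    · simp [gaussG, e]
    obtain ⟨p, hp, m, rfl⟩ := Nat.exists_prime_and_dvd hq1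
    have : Fact p.Prime := ⟨hp⟩
    obtain ⟨hpo, hmo⟩ := Nat.odd_mul.1 hodd
    have hp2 : p ≠ 2 := by
      rintro rfl
      exact absurd hpo (by decide)
    have : NeZero m := ⟨hmo.pos.ne'⟩
    have unit_of_coprime {b : ℤ} (hb : IsCoprime b (p : ℤ)) : (b : ZMod p) ≠ 0 :=
      ((ZMod.coe_int_isUnit_iff_isCoprime b p).2 hb.symm).ne_zero
    push_cast at h
    have hap := h.of_mul_right_left
    have ham := h.of_mul_right_right
    by_cases hpm : p ∣ m
    · obtain ⟨n, rfl⟩ := hpm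
      have : NeZero n := ⟨(Nat.odd_mul.1 hmo).2.pos.ne'⟩
      have hn : n < p * (p * n) := by
        have := NeZero.pos n
        nlinarith [Nat.mul_le_mul_right n hp.two_le, Nat.le_mul_of_pos_left (p * n) hp.pos]
      push_cast at ham
      rw [gaussG_prime_sq_mul a p n hp2 (unit_of_coprime hap),
        gaussG_prime_sq_mul 1 p n hp2 (by simp),
        ih n hn (Nat.odd_mul.1 hmo).2 a ham.of_mul_right_right,
        jacobiSym.mul_right, jacobiSym.mul_right, ← mul_assoc (jacobiSym a p), ← sq,
        jacobiSym.sq_one (Int.isCoprime_iff_gcd_eq_one.1 hap)]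
      push_cast
      ring
    · have hc : p.Coprime m := (Nat.Prime.coprime_iff_not_dvd hp).2 hpm
      have hpm' : IsCoprime (p : ℤ) (m : ℤ) := Nat.isCoprime_iff_coprime.2 hc
      have hlt : m < p * m := lt_mul_of_one_lt_left (NeZero.pos m) hp.one_lt
      rw [gaussG_mul_of_coprime a hc, gaussG_mul_of_coprime 1 hc, one_mul, one_mul,
        gaussG_prime (a * m) p hp2 (unit_of_coprime (hap.mul_left hpm'.symm)),
        gaussG_prime m p hp2 (unit_of_coprime hpm'.symm),
        ih m hlt hmo (a * p) (ham.mul_left hpm'), ih m hlt hmo p hpm',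
        jacobiSym.mul_right, jacobiSym.mul_left, jacobiSym.mul_left]
      push_cast
      ring

open Complex Filter Topology in
theorem tendsto_jacobiTheta₂_one {ι : Type*} {l : Filter ι} (x : ℝ) {τ : ι → ℂ}
    (hτ : Tendsto (fun i ↦ (τ i).im) l atTop) :
    Tendsto (fun i ↦ jacobiTheta₂ x (τ i)) l (𝓝 1) := by
  have hsum : ∑' n : ℤ, (if n = 0 then (1 : ℂ) else 0) = 1 := tsum_ite_eq _ _
  rw [← hsum]
  have hb := summable_pow_mul_jacobiTheta₂_term_bound 0 one_pos 0
  simp only [pow_zero, one_mul] at hb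
  refine tendsto_tsum_of_dominated_convergence hb (fun n ↦ ?_) ?_
  · split_ifs with hn
    · subst hn
      simpa [jacobiTheta₂_term] using tendsto_const_nhds
    · rw [tendsto_zero_iff_norm_tendsto_zero]
      simp only [norm_jacobiTheta₂_term, ofReal_im, mul_zero, sub_zero]
      refine Real.tendsto_exp_atBot.comp (hτ.const_mul_atTop_of_neg ?_)
      have : (0 : ℝ) < (n : ℝ) ^ 2 := by positivity
      nlinarith [Real.pi_pos]
  · filter_upwards [hτ.eventually_ge_atTop 1] with i hi n
    simpa using norm_jacobiTheta₂_term_le (S := 0) one_pos (z := x) (by simp) hi n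

open Complex in
/-- Splitting into residue classes modulo `N` and applying the functional equation of the theta
function to each class. -/
theorem jacobiTheta_add_eq_sum (N : ℕ) [NeZero N] (a : ℝ) (w : ℂ) (hw : 0 < w.re)
    (ha : ∀ k r : ℤ, cexp (Real.pi * I * (r + N * k) ^ 2 * a) = cexp (Real.pi * I * r ^ 2 * a)) :
    jacobiTheta (a + I * w) = 1 / (N ^ 2 * w) ^ (1 / 2 : ℂ) *
      ∑ r ∈ Finset.range N, cexp (Real.pi * I * r ^ 2 * a) *
        jacobiTheta₂ ((r / N : ℝ) : ℂ) (I / (N ^ 2 * w)) := by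
  have hw0 : w ≠ 0 := by
    rintro rfl
    simp at hw
  have hN : (N : ℂ) ≠ 0 := NeZero.ne _
  have him : 0 < (a + I * w : ℂ).im := by simpa using hw
  have hsum : Summable fun n : ℤ ↦ cexp (Real.pi * I * (n : ℂ) ^ 2 * (a + I * w)) := by
    have := (summable_jacobiTheta₂_term_iff 0 (a + I * w)).2 him
    simpa [jacobiTheta₂_term] using this
  have hcls (r : ℕ) : ∑' k : ℤ, cexp (Real.pi * I * ((r + N * k : ℤ) : ℂ) ^ 2 * (a + I * w)) =
      1 / (N ^ 2 * w) ^ (1 / 2 : ℂ) * (cexp (Real.pi * I * r ^ 2 * a) *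
        jacobiTheta₂ ((r / N : ℝ) : ℂ) (I / (N ^ 2 * w))) := by
    have hterm (k : ℤ) : cexp (Real.pi * I * ((r + N * k : ℤ) : ℂ) ^ 2 * (a + I * w)) =
        cexp (Real.pi * I * r ^ 2 * a) * cexp (-Real.pi * r ^ 2 * w) *
          jacobiTheta₂_term k (I * N * r * w) (I * (N ^ 2 * w)) := by
      have := ha k r
      push_cast at this ⊢
      rw [← this, jacobiTheta₂_term, ← Complex.exp_add, ← Complex.exp_add]
      congr 1
      linear_combination Real.pi * w * r ^ 2 * I_sq
    simp only [hterm]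
    rw [tsum_mul_left]
    change _ * jacobiTheta₂ _ _ = _
    rw [jacobiTheta₂_functional_equation]
    have e1 : -I * (I * (N ^ 2 * w)) = N ^ 2 * w := by
      linear_combination (-N ^ 2 * w) * I_sq
    have e2 : I * N * r * w / (I * (N ^ 2 * w)) = ((r / N : ℝ) : ℂ) := by
      push_cast
      field_simp
    have e3 : -1 / (I * (N ^ 2 * w)) = I / (N ^ 2 * w) := by
      field_simp
      rw [I_sq]
    have e4 : cexp (-Real.pi * I * (I * N * r * w) ^ 2 / (I * (N ^ 2 * w))) =
        (cexp (-Real.pi * r ^ 2 * w))⁻¹ := by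
      rw [← Complex.exp_neg]
      congr 1
      field_simp
      rw [I_sq]
      ring
    rw [e1, e2, e3, e4]
    have := Complex.exp_ne_zero (-Real.pi * r ^ 2 * w)
    field_simp
  have hs := ((Equiv.prodComm _ _).trans (Int.divModEquiv N).symm).summable_iff.2 hsum
  rw [jacobiTheta, ← ((Equiv.prodComm _ _).trans (Int.divModEquiv N).symm).tsum_eq]
  refine hs.tsum_prod.trans ?_
  rw [tsum_fintype, Finset.sum_range, Finset.mul_sum]
  refine Finset.sum_congr rfl fun r _ ↦ ?_
  rw [← hcls]
  refine tsum_congr fun k ↦ ?_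
  simp [mul_comm, add_comm]

open Complex in
theorem ofReal_mul_cpow_of_pos {t : ℝ} (ht : 0 < t) {z : ℂ} (hz : z ≠ 0) (s : ℂ) :
    ((t : ℂ) * z) ^ s = (t : ℂ) ^ s * z ^ s := by
  have ht' : (t : ℂ) ≠ 0 := ofReal_ne_zero.2 ht.ne'
  rw [cpow_def_of_ne_zero (mul_ne_zero ht' hz), cpow_def_of_ne_zero ht', cpow_def_of_ne_zero hz,
    log_ofReal_mul ht hz, ofReal_log ht.le, add_mul, Complex.exp_add]

open Complex in
/-- Both sides of the modular transformation of `jacobiTheta` at `2 / q + I * t`, split into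
residue classes modulo `q` and modulo `2` respectively. -/
theorem sum_jacobiTheta₂_eq (q : ℕ) [NeZero q] {t : ℝ} (ht : 0 < t) :
    1 / ((q : ℂ) ^ 2) ^ (1 / 2 : ℂ) *
      ∑ r ∈ Finset.range q, cexp (Real.pi * I * r ^ 2 * (2 / q : ℝ)) *
        jacobiTheta₂ ((r / q : ℝ) : ℂ) (I / (q ^ 2 * t)) =
    1 / (-I * ((2 / q : ℝ) + I * t)) ^ (1 / 2 : ℂ) *
      (1 / (4 * (q ^ 2 / (4 + 2 * I * q * t))) ^ (1 / 2 : ℂ) *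
      ∑ r ∈ Finset.range 2, cexp (Real.pi * I * r ^ 2 * (-q / 2 : ℝ)) *
        jacobiTheta₂ ((r / (2 : ℕ) : ℝ) : ℂ) (-1 / (2 * q) + I / (q ^ 2 * t))) := by
  have hq : (q : ℂ) ≠ 0 := NeZero.ne _
  have ht' : (t : ℂ) ≠ 0 := ofReal_ne_zero.2 ht.ne'
  have hden : (4 + 2 * I * q * t : ℂ) ≠ 0 := fun h ↦ by simpa using congrArg re h
  set τ : ℂ := (2 / q : ℝ) + I * t with hτ
  have him : 0 < τ.im := by simpa [hτ] using ht
  have hτ0 : τ ≠ 0 := by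
    intro h
    simp [h] at him
  set v : ℂ := t * (q ^ 2 / (4 + 2 * I * q * t)) with hv
  have hv0 : v ≠ 0 := by
    rw [hv]
    positivity
  have hinv : -1 / τ = ((-q / 2 : ℝ) : ℂ) + I * v := by
    have h4 : (4 + 2 * I * q * t : ℂ) = 2 * q * τ := by
      rw [hτ]
      push_cast
      field_simp
      ring
    rw [hv, h4]
    field_simp
    rw [hτ]
    push_cast
    field_simp
    ring
  have hvre : 0 < v.re := by
    have h : (-1 / τ).im = v.re := by
      rw [hinv]
      simp
    rw [← h, neg_div, one_div, neg_im, inv_im]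
    have := normSq_pos.2 hτ0
    rw [neg_div, neg_neg]
    positivity
  have hleft := jacobiTheta_add_eq_sum q (2 / q) t (by simpa using ht) fun k r ↦
    Complex.exp_eq_exp_iff_exists_int.2 ⟨2 * r * k + q * k ^ 2, by
      push_cast
      field_simp
      ring⟩
  have hright := jacobiTheta_add_eq_sum 2 (-q / 2) v hvre fun k r ↦
    Complex.exp_eq_exp_iff_exists_int.2 ⟨-q * (r * k + k ^ 2), by
      push_cast
      ring⟩
  have hmod : jacobiTheta τ = 1 / (-I * τ) ^ (1 / 2 : ℂ) * jacobiTheta (-1 / τ) := by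
    have := jacobiTheta₂_functional_equation 0 τ
    simpa [jacobiTheta_eq_jacobiTheta₂] using this
  have hv4 : ((2 : ℕ) : ℂ) ^ 2 * v = t * (4 * (q ^ 2 / (4 + 2 * I * q * t))) := by
    rw [hv]
    push_cast
    ring
  have hIv : I / (((2 : ℕ) : ℂ) ^ 2 * v) = -1 / (2 * q) + I / (q ^ 2 * t) := by
    rw [hv]
    push_cast
    field_simp
    ring_nf
    rw [I_sq]
    ring
  have hu : (4 * (q ^ 2 / (4 + 2 * I * q * t)) : ℂ) ≠ 0 :=
    mul_ne_zero (by norm_num) (div_ne_zero (pow_ne_zero 2 hq) hden)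
  have htc : (t : ℂ) ^ (1 / 2 : ℂ) ≠ 0 := by
    rw [Ne, cpow_eq_zero_iff]
    exact fun h ↦ ht' h.1
  rw [← hinv, hIv, hv4, ofReal_mul_cpow_of_pos ht hu] at hright
  rw [← hτ, hmod, hright, mul_comm ((q : ℂ) ^ 2) (t : ℂ),
    ofReal_mul_cpow_of_pos ht (pow_ne_zero 2 hq)] at hleft
  rw [mul_comm (t : ℂ) ((q : ℂ) ^ 2)] at hleft
  refine mul_left_cancel₀ (inv_ne_zero htc) ?_
  simp only [one_div, mul_inv] at hleft ⊢
  linear_combination -hleft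

open Complex Filter Topology in
theorem gaussG_one (q : ℕ) [NeZero q] :
    gaussG 1 0 q = (1 + I) / 2 * (1 + (-I) ^ q) * (Real.sqrt q : ℂ) := by
  have hq : (q : ℂ) ≠ 0 := NeZero.ne _
  have hq0 : (0 : ℝ) < q := Nat.cast_pos.2 (NeZero.pos q)
  have ht0 : Tendsto (fun t : ℝ ↦ (t : ℂ)) (𝓝[>] 0) (𝓝 0) := by
    have : Tendsto (fun t : ℝ ↦ (t : ℂ)) (𝓝 0) (𝓝 ((0 : ℝ) : ℂ)) :=
      continuous_ofReal.tendsto 0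
    exact (by simpa using this : Tendsto (fun t : ℝ ↦ (t : ℂ)) (𝓝 0) (𝓝 0)).mono_left
      nhdsWithin_le_nhds
  have him (b : ℝ) : Tendsto (fun t : ℝ ↦ ((b : ℂ) + I / (q ^ 2 * t)).im) (𝓝[>] 0) atTop := by
    have h (t : ℝ) : ((b : ℂ) + I / (q ^ 2 * t)).im = ((q : ℝ) ^ 2)⁻¹ * t⁻¹ := by
      have : (I / (q ^ 2 * t) : ℂ) = I * (((q : ℝ) ^ 2)⁻¹ * t⁻¹ : ℝ) := by
        push_cast
        rw [div_eq_mul_inv, mul_inv]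
      rw [this, add_im, ofReal_im, I_mul_im, ofReal_re, zero_add]
    simp only [h]
    exact tendsto_inv_nhdsGT_zero.const_mul_atTop (by positivity)
  have hθ (b x : ℝ) : Tendsto (fun t : ℝ ↦ jacobiTheta₂ x ((b : ℂ) + I / (q ^ 2 * t)))
      (𝓝[>] 0) (𝓝 1) := tendsto_jacobiTheta₂_one x (him b)
  have hL := (tendsto_finsetSum (Finset.range q) fun r _ ↦
    (hθ 0 (r / q)).const_mul (cexp (Real.pi * I * r ^ 2 * (2 / q : ℝ)))).const_mul
      (1 / ((q : ℂ) ^ 2) ^ (1 / 2 : ℂ))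
  have hS := tendsto_finsetSum (Finset.range 2) fun r _ ↦
    (hθ (-1 / (2 * q)) (r / (2 : ℕ))).const_mul (cexp (Real.pi * I * r ^ 2 * (-q / 2 : ℝ)))
  have hτ : Tendsto (fun t : ℝ ↦ 1 / (-I * ((2 / q : ℝ) + I * t)) ^ (1 / 2 : ℂ)) (𝓝[>] 0)
      (𝓝 (1 / (-I * ((2 / q : ℝ) + I * 0)) ^ (1 / 2 : ℂ))) := by
    have hb : -I * ((2 / q : ℝ) + I * 0) ∈ slitPlane := by
      refine Or.inr ?_
      simp
      exact NeZero.ne q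
    refine Tendsto.div tendsto_const_nhds (Tendsto.cpow ?_ tendsto_const_nhds hb) ?_
    · exact (tendsto_const_nhds.add (ht0.const_mul I)).const_mul (-I)
    · rw [Ne, cpow_eq_zero_iff]
      exact fun h ↦ slitPlane_ne_zero hb h.1
  have hu : Tendsto (fun t : ℝ ↦ 1 / (4 * (q ^ 2 / (4 + 2 * I * q * t)) : ℂ) ^ (1 / 2 : ℂ))
      (𝓝[>] 0) (𝓝 (1 / ((q : ℂ) ^ 2) ^ (1 / 2 : ℂ))) := by
    have hb : (q : ℂ) ^ 2 ∈ slitPlane := by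
      refine Or.inl ?_
      have : (q : ℂ) ^ 2 = ((q ^ 2 : ℝ) : ℂ) := by push_cast; rfl
      rw [this, ofReal_re]
      positivity
    refine Tendsto.div tendsto_const_nhds (Tendsto.cpow ?_ tendsto_const_nhds hb) ?_
    · have h := ((tendsto_const_nhds (x := (q : ℂ) ^ 2)).div
        ((ht0.const_mul (2 * I * q)).const_add (4 : ℂ)) (by simp)).const_mul (4 : ℂ)
      have h4 : (4 : ℂ) * (q ^ 2 / (4 + 2 * I * q * 0)) = q ^ 2 := by
        rw [mul_zero, add_zero]
        field_simp
      rwa [h4] at h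
    · rw [Ne, cpow_eq_zero_iff]
      exact fun h ↦ slitPlane_ne_zero hb h.1
  have heq := tendsto_nhds_unique_of_eventuallyEq hL (hτ.mul (hu.mul hS)) <| by
    filter_upwards [self_mem_nhdsWithin] with t ht
    simpa using sum_jacobiTheta₂_eq q ht
  have hG : gaussG 1 0 q =
      ∑ r ∈ Finset.range q, cexp (Real.pi * I * r ^ 2 * (2 / q : ℝ)) * 1 := by
    refine Finset.sum_congr rfl fun r _ ↦ ?_
    rw [e, mul_one]
    congr 1
    push_cast
    field_simp
    ring
  have hsq : (Real.sqrt q : ℂ) ^ 2 = q := by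
    rw [← ofReal_pow, Real.sq_sqrt hq0.le, ofReal_natCast]
  have hs0 : (Real.sqrt q : ℂ) ≠ 0 := ofReal_ne_zero.2 (Real.sqrt_pos.2 hq0).ne'
  have hroot : (-I * ((2 / q : ℝ) + I * 0)) ^ (1 / 2 : ℂ) = (1 - I) / (Real.sqrt q : ℂ) := by
    have h : -I * ((2 / q : ℝ) + I * 0) = ((1 - I) / (Real.sqrt q : ℂ)) ^ 2 := by
      rw [div_pow, hsq, sub_sq, I_sq]
      push_cast
      ring
    rw [h, one_div, sq_cpow_two_inv]
    rw [div_ofReal_re]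
    simpa using hq0
  have hpow : cexp (Real.pi * I * (-q / 2 : ℝ)) = (-I) ^ q := by
    rw [← exp_neg_pi_div_two_mul_I, ← Complex.exp_nat_mul]
    congr 1
    push_cast
    ring
  have hqc : ((q : ℂ) ^ 2) ^ (1 / 2 : ℂ) ≠ 0 := by
    rw [Ne, cpow_eq_zero_iff]
    exact fun h ↦ pow_ne_zero 2 hq h.1
  rw [← hG, hroot, Finset.sum_range_succ, Finset.sum_range_one] at heq
  simp only [Nat.cast_one, Nat.cast_zero, one_pow, mul_one, hpow] at heq
  have h1I : (1 - I : ℂ) ≠ 0 := fun h ↦ by simpa using congrArg re h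
  field_simp at heq
  simp at heq
  rw [eq_comm]
  apply mul_left_cancel₀ h1I
  linear_combination - heq - (1 + (-I) ^ q) * (Real.sqrt q : ℂ) / 2 * I_sq

/-- For odd positive `q` and `gcd(a,q)=1`, `G(a,0;q) = (a/q) ε_q √q`
with `(a/q)` the Jacobi symbol, `ε_q = 1` if `q ≡ 1 (mod 4)`, `ε_q = i` if `q ≡ 3 (mod 4)`. -/
theorem gauss_sum_eval (a : ℤ) (q : ℕ) (hq : 1 ≤ q) (hodd : Odd q)
    (h : Int.gcd a q = 1) :
    gaussG a 0 q =
      (jacobiSym a q : ℂ) * (if q % 4 = 1 then 1 else Complex.I) * (Real.sqrt q : ℂ) := by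
  have : NeZero q := ⟨by omega⟩
  rw [gaussG_eq_jacobiSym_mul q hodd a (Int.isCoprime_iff_gcd_eq_one.2 h), gaussG_one, ← mul_assoc]
  congr 2
  obtain ⟨k, hk⟩ : ∃ k, q = 4 * k + q % 4 := ⟨q / 4, (Nat.div_add_mod q 4).symm⟩
  have hI : (-Complex.I) ^ 4 = 1 := by rw [neg_pow, Complex.I_pow_four]; norm_num
  have hpow : (-Complex.I) ^ q = (-Complex.I) ^ (q % 4) := by
    conv_lhs => rw [hk, pow_add, pow_mul, hI, one_pow, one_mul]
  rw [hpow]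
  have hodd' := Nat.odd_iff.1 hodd
  rcases (by omega : q % 4 = 1 ∨ q % 4 = 3) with h4 | h4
  · rw [h4, if_pos rfl]
    linear_combination -(1 / 2 : ℂ) * Complex.I_sq
  · rw [h4, if_neg (by decide)]
    linear_combination (-Complex.I / 2 - Complex.I ^ 2 / 2 + 1 / 2) * Complex.I_sq
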